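/- Let L = {x ∈ ℤ⁴ : x₁ and x₂ are even}, a finite-index subgroup of ℤ⁴. Then for every A ∈ Sp(4,ℤ), one has A·L = L if and only if the eight entries A₁₃, A₁₄, A₂₃, A₂₄, A₃₁, A₃₂, A₄₁, A₄₂ are all even. -/

import Mathlib

/-- The standard symplectic form on `ℤ⁴`: `ω(x,y) = x₁y₂ − x₂y₁ + x₃y₄ − x₄y₃`
(written with 0-based indices). -/
def omegaZ (x y : Fin 4 → ℤ) : ℤ :=
  x 0 * y 1 - x 1 * y 0 + x 2 * y 3 - x 3 * y 2

/-- `A ∈ Sp(4,ℤ)`: `A` preserves the symplectic form `ω`. -/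
def IsSymp (A : Matrix (Fin 4) (Fin 4) ℤ) : Prop :=
  ∀ x y : Fin 4 → ℤ, omegaZ (A.mulVec x) (A.mulVec y) = omegaZ x y

theorem IsSymp.omegaZ_col {A : Matrix (Fin 4) (Fin 4) ℤ} (hA : IsSymp A) (i j : Fin 4) :
    omegaZ (A.col i) (A.col j) = omegaZ (Pi.single i 1) (Pi.single j 1) := by
  simpa only [Matrix.mulVec_single_one] using hA (Pi.single i 1) (Pi.single j 1)

/-- The symplectic adjoint `−J Aᵀ J`, where `J` is the Gram matrix of `omegaZ`. -/
def sympAdjoint (A : Matrix (Fin 4) (Fin 4) ℤ) : Matrix (Fin 4) (Fin 4) ℤ :=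
  !![A 1 1, -A 0 1, A 3 1, -A 2 1;
     -A 1 0, A 0 0, -A 3 0, A 2 0;
     A 1 3, -A 0 3, A 3 3, -A 2 3;
     -A 1 2, A 0 2, -A 3 2, A 2 2]

theorem IsSymp.sympAdjoint_mul {A : Matrix (Fin 4) (Fin 4) ℤ} (hA : IsSymp A) :
    sympAdjoint A * A = 1 := by
  have h01 := hA.omegaZ_col 0 1
  have h02 := hA.omegaZ_col 0 2
  have h03 := hA.omegaZ_col 0 3
  have h12 := hA.omegaZ_col 1 2
  have h13 := hA.omegaZ_col 1 3
  have h23 := hA.omegaZ_col 2 3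
  simp [omegaZ] at h01 h02 h03 h12 h13 h23
  ext i j
  fin_cases i <;> fin_cases j <;>
    simp [sympAdjoint, Matrix.mul_apply, Fin.sum_univ_four] <;> linarith

theorem IsSymp.mulVec_sympAdjoint {A : Matrix (Fin 4) (Fin 4) ℤ} (hA : IsSymp A)
    (x : Fin 4 → ℤ) : A.mulVec ((sympAdjoint A).mulVec x) = x := by
  rw [Matrix.mulVec_mulVec, mul_eq_one_comm.mp hA.sympAdjoint_mul, Matrix.one_mulVec]

/-- If the upper right block of a symplectic matrix is even, so is its lower left block. -/
theorem IsSymp.even_lower_left {A : Matrix (Fin 4) (Fin 4) ℤ} (hA : IsSymp A)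
    (h02 : (2 : ℤ) ∣ A 0 2) (h03 : (2 : ℤ) ∣ A 0 3)
    (h12 : (2 : ℤ) ∣ A 1 2) (h13 : (2 : ℤ) ∣ A 1 3) (j : Fin 4) (hj : j = 0 ∨ j = 1) :
    (2 : ℤ) ∣ A 2 j ∧ (2 : ℤ) ∣ A 3 j := by
  have e2 : A 0 j * A 1 2 - A 1 j * A 0 2 + A 2 j * A 3 2 - A 3 j * A 2 2 = 0 := by
    have h := hA.omegaZ_col j 2
    rcases hj with rfl | rfl <;> simpa [omegaZ, Pi.single_apply] using h
  have e3 : A 0 j * A 1 3 - A 1 j * A 0 3 + A 2 j * A 3 3 - A 3 j * A 2 3 = 0 := by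
    have h := hA.omegaZ_col j 3
    rcases hj with rfl | rfl <;> simpa [omegaZ, Pi.single_apply] using h
  have e23 : A 0 2 * A 1 3 - A 1 2 * A 0 3 + A 2 2 * A 3 3 - A 3 2 * A 2 3 = 1 := by
    have h := hA.omegaZ_col 2 3
    simp [omegaZ] at h
    linarith
  obtain ⟨a, ha⟩ := h02
  obtain ⟨b, hb⟩ := h03
  obtain ⟨c, hc⟩ := h12
  obtain ⟨d, hd⟩ := h13
  rw [ha, hc] at e2
  rw [hb, hd] at e3
  rw [ha, hb, hc, hd] at e23
  constructor
  · refine ⟨A 2 j * (2 * a * d - 2 * c * b) + A 2 3 * (A 0 j * c - A 1 j * a)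
      - A 2 2 * (A 0 j * d - A 1 j * b), ?_⟩
    linear_combination (-A 2 j) * e23 - A 2 3 * e2 + A 2 2 * e3
  · refine ⟨A 3 j * (2 * a * d - 2 * c * b) + A 3 3 * (A 0 j * c - A 1 j * a)
      - A 3 2 * (A 0 j * d - A 1 j * b), ?_⟩
    linear_combination (-A 3 j) * e23 - A 3 3 * e2 + A 3 2 * e3

/-- A matrix with even upper right block preserves the vectors whose first two
coordinates are even. -/
theorem even_mulVec {A : Matrix (Fin 4) (Fin 4) ℤ}
    (h02 : (2 : ℤ) ∣ A 0 2) (h03 : (2 : ℤ) ∣ A 0 3)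
    (h12 : (2 : ℤ) ∣ A 1 2) (h13 : (2 : ℤ) ∣ A 1 3) {x : Fin 4 → ℤ}
    (hx : (2 : ℤ) ∣ x 0 ∧ (2 : ℤ) ∣ x 1) :
    (2 : ℤ) ∣ A.mulVec x 0 ∧ (2 : ℤ) ∣ A.mulVec x 1 := by
  simp only [Matrix.mulVec, dotProduct, Fin.sum_univ_four]
  exact ⟨dvd_add (dvd_add (dvd_add (hx.1.mul_left _) (hx.2.mul_left _)) (h02.mul_right _))
      (h03.mul_right _),
    dvd_add (dvd_add (dvd_add (hx.1.mul_left _) (hx.2.mul_left _)) (h12.mul_right _))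
      (h13.mul_right _)⟩

/-- For `L = {x ∈ ℤ⁴ : x₁, x₂ even}` and any `A ∈ Sp(4,ℤ)`, one has `A·L = L` if and only
if the entries `A₁₃, A₁₄, A₂₃, A₂₄, A₃₁, A₃₂, A₄₁, A₄₂` are all even
(1-based entries; 0-based `(0,2), (0,3), (1,2), (1,3), (2,0), (2,1), (3,0), (3,1)`). -/
theorem symplectic_criterion_klein_cover
    (A : Matrix (Fin 4) (Fin 4) ℤ) (hA : IsSymp A) :
    A.mulVec '' {x : Fin 4 → ℤ | (2 : ℤ) ∣ x 0 ∧ (2 : ℤ) ∣ x 1} =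
        {x : Fin 4 → ℤ | (2 : ℤ) ∣ x 0 ∧ (2 : ℤ) ∣ x 1} ↔
      ((2 : ℤ) ∣ A 0 2 ∧ (2 : ℤ) ∣ A 0 3 ∧ (2 : ℤ) ∣ A 1 2 ∧ (2 : ℤ) ∣ A 1 3 ∧
       (2 : ℤ) ∣ A 2 0 ∧ (2 : ℤ) ∣ A 2 1 ∧ (2 : ℤ) ∣ A 3 0 ∧ (2 : ℤ) ∣ A 3 1) := by
  constructor
  · intro h
    have hcol (j : Fin 4) (h0 : j ≠ 0) (h1 : j ≠ 1) : (2 : ℤ) ∣ A 0 j ∧ (2 : ℤ) ∣ A 1 j := by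
      have hmem := h.subset (Set.mem_image_of_mem A.mulVec
        (show Pi.single j 1 ∈ {x : Fin 4 → ℤ | (2 : ℤ) ∣ x 0 ∧ (2 : ℤ) ∣ x 1} by
          simp [h0.symm, h1.symm]))
      simpa using hmem
    obtain ⟨h02, h12⟩ := hcol 2 (by decide) (by decide)
    obtain ⟨h03, h13⟩ := hcol 3 (by decide) (by decide)
    obtain ⟨h20, h30⟩ := hA.even_lower_left h02 h03 h12 h13 0 (Or.inl rfl)
    obtain ⟨h21, h31⟩ := hA.even_lower_left h02 h03 h12 h13 1 (Or.inr rfl)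
    exact ⟨h02, h03, h12, h13, h20, h21, h30, h31⟩
  · rintro ⟨h02, h03, h12, h13, h20, h21, h30, h31⟩
    apply Set.Subset.antisymm
    · rintro _ ⟨x, hx, rfl⟩
      exact even_mulVec h02 h03 h12 h13 hx
    · intro x hx
      refine ⟨(sympAdjoint A).mulVec x, even_mulVec ?_ ?_ ?_ ?_ hx, hA.mulVec_sympAdjoint x⟩ <;>
        simpa [sympAdjoint]
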